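/- arXiv:1903.00147 — 2 statements merged into one kernel-verified Lean document; each statement's English description precedes it below -/
import Mathlib

section
/- Let f ∈ C₀(ℝⁿ) be a pdf and g ∈ C₀(ℝⁿ) a pdf. Then there exists a sequence of finite mixtures h_m of g (convex combinations of m location-scale transforms of g) such that h_m → f almost everywhere with respect to Lebesgue measure. -/
open MeasureTheory Filter Metric Topology

open scoped BoundedContinuousFunction

section Translation

variable {E : Type*} [NormedAddCommGroup E]

/-- The translate `x ↦ u (x - y)` of a bounded continuous function. -/
noncomputable def translateBCF (u : E →ᵇ ℝ) (y : E) : E →ᵇ ℝ :=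
  u.compContinuous ⟨fun x => x - y, by fun_prop⟩

@[simp]
lemma translateBCF_apply (u : E →ᵇ ℝ) (y x : E) : translateBCF u y x = u (x - y) := rfl

@[simp]
lemma translateBCF_zero (u : E →ᵇ ℝ) : translateBCF u 0 = u := by
  ext x; simp

lemma norm_translateBCF_le (u : E →ᵇ ℝ) (y : E) : ‖translateBCF u y‖ ≤ ‖u‖ :=
  (BoundedContinuousFunction.norm_le (norm_nonneg _)).2 fun x => u.norm_coe_le_norm (x - y)

lemma continuous_translateBCF {u : E →ᵇ ℝ} (hu : UniformContinuous u) :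
    Continuous (translateBCF u) := by
  rw [Metric.continuous_iff]
  intro b ε hε
  obtain ⟨δ, hδ, h⟩ := Metric.uniformContinuous_iff.1 hu (ε / 2) (half_pos hε)
  refine ⟨δ, hδ, fun a ha => ?_⟩
  refine lt_of_le_of_lt ?_ (half_lt_self hε)
  refine (BoundedContinuousFunction.dist_le (half_pos hε).le).2 fun x => (h ?_).le
  simpa [dist_eq_norm, norm_sub_rev, sub_sub_sub_cancel_left] using ha

end Translation

section Dilation

variable {E : Type*} [NormedAddCommGroup E] [NormedSpace ℝ E]

/-- The `L¹`-normalised dilation of `u` by the factor `σ`. -/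
noncomputable def dilateBCF (u : E →ᵇ ℝ) (σ : ℝ) : E →ᵇ ℝ :=
  (σ ^ Module.finrank ℝ E)⁻¹ • u.compContinuous ⟨fun x => σ⁻¹ • x, by fun_prop⟩

@[simp]
lemma dilateBCF_apply (u : E →ᵇ ℝ) (σ : ℝ) (x : E) :
    dilateBCF u σ x = (σ ^ Module.finrank ℝ E)⁻¹ * u (σ⁻¹ • x) := rfl

lemma uniformContinuous_dilateBCF {u : E →ᵇ ℝ} (hu : UniformContinuous u) (σ : ℝ) :
    UniformContinuous (dilateBCF u σ) :=
  (hu.comp (uniformContinuous_const_smul σ⁻¹)).const_smul (σ ^ Module.finrank ℝ E)⁻¹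

end Dilation

section Mixtures

variable {E : Type*} [NormedAddCommGroup E] [NormedSpace ℝ E] [FiniteDimensional ℝ E]
  [MeasurableSpace E] [BorelSpace E] {ν : Measure E}

/-- Averages of the dilated translates `x ↦ u (x - t z)` against a probability density `g`
converge uniformly to `u` as `t → 0`. -/
lemma tendsto_integral_smul_translateBCF {u : E →ᵇ ℝ} (hu : UniformContinuous u) {g : E → ℝ}
    (hgc : Continuous g) (hg : Integrable g ν) (hg1 : ∫ z, g z ∂ν = 1) :
    Tendsto (fun t : ℝ => ∫ z, g z • translateBCF u (t • z) ∂ν) (𝓝 0) (𝓝 u) := by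
  have hT := continuous_translateBCF hu
  have key : Tendsto (fun t : ℝ => ∫ z, g z • translateBCF u (t • z) ∂ν) (𝓝 0)
      (𝓝 (∫ z, g z • u ∂ν)) := by
    refine tendsto_integral_filter_of_dominated_convergence (fun z => ‖g z‖ * ‖u‖) ?_ ?_ ?_ ?_
    · exact Eventually.of_forall fun t =>
        (hgc.smul (hT.comp (continuous_const_smul t))).aestronglyMeasurable
    · refine Eventually.of_forall fun t => Eventually.of_forall fun z => ?_
      rw [norm_smul]
      exact mul_le_mul_of_nonneg_left (norm_translateBCF_le _ _) (norm_nonneg _)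
    · exact hg.norm.mul_const _
    · refine Eventually.of_forall fun z => ?_
      have : Continuous fun t : ℝ => g z • translateBCF u (t • z) :=
        (hT.comp (continuous_id.smul continuous_const : Continuous fun t : ℝ => t • z)).const_smul
          (g z)
      simpa using this.tendsto 0
  rwa [integral_smul_const, hg1, one_smul] at key

/-- Averaging the translates of `u` against a probability density lands in the closed convex
hull of the translates. -/
lemma integral_smul_translateBCF_mem {u : E →ᵇ ℝ} (hu : UniformContinuous u) {f : E → ℝ}
    (hfc : Continuous f) (hf0 : ∀ x, 0 ≤ f x) (hf : Integrable f ν) (hf1 : ∫ y, f y ∂ν = 1) :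
    ∫ y, f y • translateBCF u y ∂ν ∈ closure (convexHull ℝ (Set.range (translateBCF u))) := by
  set P : Measure E := ν.withDensity fun y => ENNReal.ofReal (f y) with hP
  have hmeas : Measurable fun y => ENNReal.ofReal (f y) := hfc.measurable.ennreal_ofReal
  have : IsProbabilityMeasure P := by
    refine ⟨?_⟩
    rw [hP, withDensity_apply _ MeasurableSet.univ, Measure.restrict_univ,
      ← ofReal_integral_eq_lintegral_ofReal hf (Eventually.of_forall hf0), hf1,
      ENNReal.ofReal_one]
  have hI : Integrable (translateBCF u) P :=
    (integrable_const ‖u‖).mono' (continuous_translateBCF hu).aestronglyMeasurable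
      (Eventually.of_forall fun y => norm_translateBCF_le u y)
  have hmem : ∫ y, translateBCF u y ∂P ∈
      closure (convexHull ℝ (Set.range (translateBCF u))) :=
    (convex_convexHull ℝ _).closure.integral_mem isClosed_closure
      (Eventually.of_forall fun y =>
        subset_closure (subset_convexHull ℝ _ (Set.mem_range_self y))) hI
  rw [hP, integral_withDensity_eq_integral_toReal_smul hmeas
    (Eventually.of_forall fun y => ENNReal.ofReal_lt_top)] at hmem
  simpa only [ENNReal.toReal_ofReal (hf0 _)] using hmem

lemma integral_smul_translateBCF_apply {u : E →ᵇ ℝ} (hu : UniformContinuous u) {f : E → ℝ}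
    (hfc : Continuous f) (hf : Integrable f ν) {s : E → E} (hs : Continuous s) (x : E) :
    (∫ y, f y • translateBCF u (s y) ∂ν) x = ∫ y, f y * u (x - s y) ∂ν := by
  have hI : Integrable (fun y => f y • translateBCF u (s y)) ν := by
    refine (hf.norm.mul_const ‖u‖).mono'
      (hfc.smul ((continuous_translateBCF hu).comp hs)).aestronglyMeasurable
      (Eventually.of_forall fun y => ?_)
    rw [norm_smul]
    exact mul_le_mul_of_nonneg_left (norm_translateBCF_le _ _) (norm_nonneg _)
  exact ((BoundedContinuousFunction.evalCLM ℝ x).integral_comp_comm hI).symm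

lemma integral_mul_dilate_sub [ν.IsAddHaarMeasure] (f g : E → ℝ) {σ : ℝ} (hσ : 0 < σ) (x : E) :
    ∫ y, f y * ((σ ^ Module.finrank ℝ E)⁻¹ * g (σ⁻¹ • (x - y))) ∂ν =
      ∫ z, g z * f (x - σ • z) ∂ν := by
  have h1 := integral_sub_left_eq_self
    (fun y => f y * ((σ ^ Module.finrank ℝ E)⁻¹ * g (σ⁻¹ • (x - y)))) ν x
  have h2 := Measure.integral_comp_smul ν
    (fun w => g (σ⁻¹ • w) * f (x - w)) σ
  have hpos : 0 < (σ ^ Module.finrank ℝ E)⁻¹ := by positivity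
  simp only [smul_smul, inv_mul_cancel₀ hσ.ne', one_smul, abs_of_pos hpos, smul_eq_mul] at h2
  rw [← h1, h2, ← integral_const_mul]
  refine integral_congr_ae (Eventually.of_forall fun y => ?_)
  simp only [sub_sub_cancel]
  ring

/-- Some finite convex combination of translates of a dilate of the density `g` is uniformly
close to the density `f`. -/
lemma exists_dist_mem_convexHull_translateBCF_lt [ν.IsAddHaarMeasure] {f g : E →ᵇ ℝ}
    (hfu : UniformContinuous f) (hgu : UniformContinuous g)
    (hf0 : ∀ x, 0 ≤ f x) (hf : Integrable f ν) (hf1 : ∫ x, f x ∂ν = 1)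
    (hg : Integrable g ν) (hg1 : ∫ x, g x ∂ν = 1) {ε : ℝ} (hε : 0 < ε) :
    ∃ σ > 0, ∃ h ∈ convexHull ℝ (Set.range (translateBCF (dilateBCF g σ))), dist f h < ε := by
  have hlim := (tendsto_integral_smul_translateBCF hfu g.continuous hg hg1).mono_left
    (nhdsWithin_le_nhds (s := Set.Ioi 0))
  obtain ⟨σ, hclose, hσ⟩ := ((Metric.tendsto_nhds.1 hlim _ (half_pos hε)).and
    self_mem_nhdsWithin).exists
  replace hσ : 0 < σ := hσ
  have hgσ := uniformContinuous_dilateBCF hgu σ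
  have heq : ∫ z, g z • translateBCF f (σ • z) ∂ν =
      ∫ y, f y • translateBCF (dilateBCF g σ) y ∂ν := by
    ext x
    rw [integral_smul_translateBCF_apply hfu g.continuous hg (continuous_const_smul σ),
      integral_smul_translateBCF_apply hgσ f.continuous hf (s := fun y => y) continuous_id]
    exact (integral_mul_dilate_sub f g hσ x).symm
  have hmem := integral_smul_translateBCF_mem hgσ f.continuous hf0 hf hf1
  rw [← heq] at hmem
  obtain ⟨h, hh, hd⟩ := Metric.mem_closure_iff.1 hmem _ (half_pos hε)
  refine ⟨σ, hσ, h, hh, ?_⟩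
  rw [dist_comm] at hclose
  linarith [dist_triangle f (∫ z, g z • translateBCF f (σ • z) ∂ν) h]

end Mixtures

/-- The location-scale mixtures of `g` with `m` components. -/
def finiteMixtures {n : ℕ} (g : EuclideanSpace ℝ (Fin n) → ℝ) (m : ℕ) :
    Set (EuclideanSpace ℝ (Fin n) → ℝ) :=
  {h | ∃ (c : Fin m → ℝ) (μ : Fin m → EuclideanSpace ℝ (Fin n)) (σ : Fin m → ℝ),
    (∀ i, 0 < σ i) ∧ (∀ i, 0 ≤ c i) ∧ (∑ i, c i = 1) ∧
    h = fun x => ∑ i, c i * ((σ i) ^ n)⁻¹ * g ((σ i)⁻¹ • (x - μ i))}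

lemma finiteMixtures_mono {n : ℕ} (g : EuclideanSpace ℝ (Fin n) → ℝ) :
    Monotone (finiteMixtures g) := by
  refine monotone_nat_of_le_succ fun m => ?_
  rintro h ⟨c, μ, σ, hσ, hc, hc1, rfl⟩
  refine ⟨Fin.snoc c 0, Fin.snoc μ 0, Fin.snoc σ 1, fun i => ?_, fun i => ?_, ?_, ?_⟩
  · induction i using Fin.lastCases <;> simp [hσ]
  · induction i using Fin.lastCases <;> simp [hc]
  · simp [Fin.sum_univ_castSucc, hc1]
  · ext x
    simp [Fin.sum_univ_castSucc]

lemma finiteMixtures_nonempty {n : ℕ} (g : EuclideanSpace ℝ (Fin n) → ℝ) {m : ℕ} (hm : 1 ≤ m) :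
    (finiteMixtures g m).Nonempty :=
  Set.Nonempty.mono (finiteMixtures_mono g hm)
    ⟨_, fun _ => 1, fun _ => 0, fun _ => 1, by simp, by simp, by simp, rfl⟩

lemma exists_mem_finiteMixtures_of_mem_convexHull {n : ℕ} (g : EuclideanSpace ℝ (Fin n) →ᵇ ℝ)
    {σ : ℝ} (hσ : 0 < σ) {h : EuclideanSpace ℝ (Fin n) →ᵇ ℝ}
    (hh : h ∈ convexHull ℝ (Set.range (translateBCF (dilateBCF g σ)))) :
    ∃ m, ⇑h ∈ finiteMixtures g m := by
  obtain ⟨ι, _, w, z, hw, hw1, hz, rfl⟩ := mem_convexHull_iff_exists_fintype.1 hh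
  choose μ hμ using hz
  let e := Fintype.equivFin ι
  refine ⟨Fintype.card ι, w ∘ e.symm, μ ∘ e.symm, fun _ => σ, fun _ => hσ, fun _ => hw _, ?_, ?_⟩
  · rw [← hw1]
    exact e.symm.sum_comp w
  · ext x
    refine Eq.trans ?_ (e.symm.sum_comp
      fun i => w i * (σ ^ n)⁻¹ * g (σ⁻¹ • (x - μ i))).symm
    simp [← hμ, mul_assoc]

/-- A monotone family of sets, eventually nonempty, whose union comes arbitrarily close to `f`
admits a selection converging to `f` uniformly. -/
lemma exists_selection_tendstoUniformly {X : Type*} {S : ℕ → Set (X → ℝ)} (hS : Monotone S)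
    (hne : ∀ m, 1 ≤ m → (S m).Nonempty) {f : X → ℝ}
    (happ : ∀ ε > 0, ∃ m, ∃ h ∈ S m, ∀ x, dist (f x) (h x) < ε) :
    ∃ h : ℕ → X → ℝ, (∀ m, 1 ≤ m → h m ∈ S m) ∧ TendstoUniformly h f atTop := by
  classical
  let Q : ℕ → ℕ → (X → ℝ) → Prop := fun m j h =>
    h ∈ S m ∧ (0 < j → ∀ x, dist (f x) (h x) < 1 / (j : ℝ))
  let J : ℕ → ℕ := fun m => Nat.findGreatest (fun j => ∃ h, Q m j h) m
  have hJ : ∀ m, 1 ≤ m → ∃ h, Q m (J m) h := fun m hm =>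
    Nat.findGreatest_spec (P := fun j => ∃ h, Q m j h) (Nat.zero_le m)
      ((hne m hm).imp fun h hh => ⟨hh, fun h0 => absurd h0 (lt_irrefl 0)⟩)
  choose! h hh using hJ
  refine ⟨h, fun m hm => (hh m hm).1, Metric.tendstoUniformly_iff.2 fun ε hε => ?_⟩
  obtain ⟨k, hk⟩ := exists_nat_one_div_lt hε
  obtain ⟨M, h', hM, hd⟩ := happ (1 / ((k : ℝ) + 1)) (by positivity)
  filter_upwards [eventually_ge_atTop M, eventually_ge_atTop (k + 1)] with m hmM hmk x
  have hle : k + 1 ≤ J m :=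
    Nat.le_findGreatest hmk ⟨h', hS hmM hM, fun _ => by simpa using hd⟩
  refine ((hh m (by omega)).2 (by omega) x).trans_le (le_trans ?_ hk.le)
  exact one_div_le_one_div_of_le (by positivity) (by exact_mod_cast hle)

/-- Theorem (d): for pdfs `f, g ∈ C₀(ℝⁿ)` there is a sequence of finite location-scale
mixtures of `g` (the `m`-th having `m` components) converging to `f` Lebesgue-almost
everywhere. -/
theorem stmt_8 (n : ℕ) (f g : EuclideanSpace ℝ (Fin n) → ℝ)
    (hf0 : ∀ x, 0 ≤ f x) (hfint : Integrable f) (hf1 : ∫ x, f x = 1)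
    (hfc : Continuous f)
    (hfC0 : Tendsto f (cocompact (EuclideanSpace ℝ (Fin n))) (𝓝 0))
    (hg0 : ∀ x, 0 ≤ g x) (hgint : Integrable g) (hg1 : ∫ x, g x = 1)
    (hgc : Continuous g)
    (hgC0 : Tendsto g (cocompact (EuclideanSpace ℝ (Fin n))) (𝓝 0)) :
    ∃ h : ℕ → EuclideanSpace ℝ (Fin n) → ℝ,
      (∀ m : ℕ, 1 ≤ m →
        ∃ (c : Fin m → ℝ) (μ : Fin m → EuclideanSpace ℝ (Fin n)) (σ : Fin m → ℝ),
          (∀ i, 0 < σ i) ∧ (∀ i, 0 ≤ c i) ∧ (∑ i, c i = 1) ∧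
          h m = fun x => ∑ i, c i * ((σ i) ^ n)⁻¹ * g ((σ i)⁻¹ • (x - μ i))) ∧
      ∀ᵐ x ∂(volume : Measure (EuclideanSpace ℝ (Fin n))),
        Tendsto (fun m => h m x) atTop (𝓝 (f x)) := by
  have hfu : UniformContinuous f := hfc.uniformContinuous_of_tendsto_cocompact hfC0
  have hgu : UniformContinuous g := hgc.uniformContinuous_of_tendsto_cocompact hgC0
  let F := ZeroAtInftyContinuousMap.toBCF ⟨⟨f, hfc⟩, hfC0⟩
  let G := ZeroAtInftyContinuousMap.toBCF ⟨⟨g, hgc⟩, hgC0⟩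
  obtain ⟨h, hmem, hlim⟩ := exists_selection_tendstoUniformly (finiteMixtures_mono g)
    (fun m hm => finiteMixtures_nonempty g hm) (f := f) fun ε hε => by
      obtain ⟨σ, hσ, k, hk, hd⟩ := exists_dist_mem_convexHull_translateBCF_lt (f := F) (g := G)
        hfu hgu hf0 hfint hf1 hgint hg1 hε
      obtain ⟨m, hm⟩ := exists_mem_finiteMixtures_of_mem_convexHull G hσ hk
      exact ⟨m, k, hm, fun x => (BoundedContinuousFunction.dist_coe_le_dist x).trans_lt hd⟩
  exact ⟨h, hmem, Eventually.of_forall fun x => hlim.tendsto_at x⟩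
end

section
/- Let f be a continuous pdf on ℝⁿ, and let g be a pdf with g ∈ 𝒱, i.e., g is continuous, vanishes at infinity, and satisfies |g(x)| ≤ β(1 + ‖x‖₂)^{−n−θ} for some β, θ > 0. Then for every ε > 0 there exists a finite mixture h = Σᵢ₌₁ᵐ cᵢ σᵢ⁻ⁿ g((x − μᵢ)/σᵢ) with cᵢ ≥ 0, Σ cᵢ = 1, such that ‖f − h‖_{L¹} < ε. -/
open MeasureTheory Filter Metric Topology

/-- A weighted average of points of a set with respect to a probability density lies in the
closed convex hull of the set. -/
theorem integral_smul_mem_closure_convexHull {E F : Type*} [MeasurableSpace E] {ν : Measure E}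
    [NormedAddCommGroup F] [NormedSpace ℝ F] [CompleteSpace F] {f : E → ℝ}
    (hf0 : ∀ x, 0 ≤ f x) (hf : Integrable f ν) (hfm : Measurable f) (hf1 : ∫ x, f x ∂ν = 1)
    {φ : E → F} (hφ : Integrable (fun x => f x • φ x) ν) {s : Set F} (hs : ∀ x, φ x ∈ s) :
    ∫ x, f x • φ x ∂ν ∈ closure (convexHull ℝ s) := by
  have hm : Measurable fun x => ENNReal.ofReal (f x) := hfm.ennreal_ofReal
  have hfin : ∀ᵐ x ∂ν, ENNReal.ofReal (f x) < ⊤ := .of_forall fun _ => ENNReal.ofReal_lt_top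
  have hprob : IsProbabilityMeasure (ν.withDensity fun x => ENNReal.ofReal (f x)) := by
    constructor
    rw [withDensity_apply _ .univ, Measure.restrict_univ,
      ← ofReal_integral_eq_lintegral_ofReal hf (.of_forall hf0), hf1, ENNReal.ofReal_one]
  have key := (convex_convexHull ℝ s).closure.integral_mem
    (μ := ν.withDensity fun x => ENNReal.ofReal (f x)) isClosed_closure
    (.of_forall fun x => subset_closure (subset_convexHull ℝ s (hs x)))
    ((integrable_withDensity_iff_integrable_smul' hm hfin).2
      (by simpa only [ENNReal.toReal_ofReal (hf0 _)] using hφ))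
  rw [integral_withDensity_eq_integral_toReal_smul hm hfin] at key
  simpa only [ENNReal.toReal_ofReal (hf0 _)] using key

section L1Translation

variable {E : Type*} [NormedAddCommGroup E] [NormedSpace ℝ E] [FiniteDimensional ℝ E]
  [MeasurableSpace E] [BorelSpace E] {ν : Measure E} [ν.IsAddHaarMeasure]

/-- The translate `x ↦ u (x - y)` of an `L¹` function. -/
noncomputable def translateL1 (y : E) (u : E →₁[ν] ℝ) : E →₁[ν] ℝ :=
  DomAddAct.mk (-y) +ᵥ u

theorem translateL1_ae_eq (y : E) (u : E →₁[ν] ℝ) :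
    translateL1 y u =ᵐ[ν] fun x => u (x - y) := by
  refine (DomAddAct.vadd_Lp_ae_eq (DomAddAct.mk (-y)) u).trans (.of_forall fun x => ?_)
  simp [neg_add_eq_sub]

theorem translateL1_toL1_ae_eq (y : E) {f : E → ℝ} (hf : Integrable f ν) :
    translateL1 y (hf.toL1 f) =ᵐ[ν] fun x => f (x - y) :=
  (translateL1_ae_eq y _).trans
    ((measurePreserving_sub_right ν y).quasiMeasurePreserving.ae_eq_comp hf.coeFn_toL1)

theorem norm_translateL1 (y : E) (u : E →₁[ν] ℝ) : ‖translateL1 y u‖ = ‖u‖ :=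
  DomAddAct.norm_vadd_Lp _ _

theorem translateL1_zero (u : E →₁[ν] ℝ) : translateL1 0 u = u := by
  simp [translateL1]

theorem continuous_translateL1 (u : E →₁[ν] ℝ) :
    Continuous fun y : E => translateL1 y u := by
  have : Fact ((1 : ENNReal) ≠ ⊤) := ⟨ENNReal.one_ne_top⟩
  have h : Continuous fun y : E => DomAddAct.mk (-y) :=
    DomAddAct.continuous_mk.comp continuous_neg
  exact h.vadd continuous_const

theorem integrable_smul_translateL1 {f : E → ℝ} (hf : Integrable f ν) (u : E →₁[ν] ℝ) :
    Integrable (fun y => f y • translateL1 y u) ν := by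
  refine (hf.norm.mul_const ‖u‖).mono'
    (hf.aestronglyMeasurable.smul (continuous_translateL1 u).aestronglyMeasurable)
    (.of_forall fun y => ?_)
  rw [norm_smul, norm_translateL1]

theorem integral_smul_translateL1_ae_eq {f g : E → ℝ} (hf : Integrable f ν)
    (hg : Integrable g ν) :
    (∫ y, f y • translateL1 y (hg.toL1 g) ∂ν : E →₁[ν] ℝ) =ᵐ[ν]
      fun x => ∫ y, f y * g (x - y) ∂ν := by
  have hprod := hf.convolution_integrand (ContinuousLinearMap.mul ℝ ℝ) hg
  simp only [ContinuousLinearMap.mul_apply'] at hprod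
  refine Integrable.ae_eq_of_forall_setIntegral_eq _ _ (L1.integrable_coeFn _)
    hprod.integral_prod_left fun s _ _ => ?_
  let Λ : (E →₁[ν] ℝ) →L[ℝ] ℝ :=
    { toFun := fun u => ∫ x in s, u x ∂ν
      map_add' := fun u v => by
        rw [integral_congr_ae (ae_restrict_of_ae (Lp.coeFn_add u v))]
        exact integral_add (L1.integrable_coeFn u).integrableOn
          (L1.integrable_coeFn v).integrableOn
      map_smul' := fun c u => by
        rw [integral_congr_ae (ae_restrict_of_ae (Lp.coeFn_smul c u))]
        exact integral_smul c _
      cont := continuous_setIntegral s }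
  have hΛ := Λ.integral_comp_comm (integrable_smul_translateL1 hf (hg.toL1 g))
  change _ = ∫ x in s, _ ∂ν at hΛ
  rw [← hΛ, integral_integral_swap]
  · refine integral_congr_ae (.of_forall fun y => ?_)
    simp only [map_smul, smul_eq_mul, integral_const_mul]
    congr 1
    exact integral_congr_ae (ae_restrict_of_ae (translateL1_toL1_ae_eq y hg))
  · exact hprod.mono_measure (Measure.prod_mono Measure.restrict_le_self le_rfl)

theorem integral_smul_translateL1_comm {f g : E → ℝ} (hf : Integrable f ν)
    (hg : Integrable g ν) :
    ∫ y, f y • translateL1 y (hg.toL1 g) ∂ν = ∫ y, g y • translateL1 y (hf.toL1 f) ∂ν := by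
  refine Lp.ext ((integral_smul_translateL1_ae_eq hf hg).trans
    (.trans (.of_forall fun x => ?_) (integral_smul_translateL1_ae_eq hg hf).symm))
  rw [← integral_sub_left_eq_self _ ν x]
  simp [mul_comm]

/-- Convolution against the dilates of a function of integral one is an approximate identity. -/
theorem tendsto_integral_smul_translateL1 {g : E → ℝ} (hg : Integrable g ν)
    (hg1 : ∫ x, g x ∂ν = 1) (u : E →₁[ν] ℝ) :
    Tendsto (fun σ : ℝ => ∫ z, g z • translateL1 (σ • z) u ∂ν) (𝓝 0) (𝓝 u) := by
  have hlim : ∫ z, g z • translateL1 ((0 : ℝ) • z) u ∂ν = u := by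
    simp [translateL1_zero, integral_smul_const, hg1]
  have hcont : Continuous fun σ : ℝ => ∫ z, g z • translateL1 (σ • z) u ∂ν := by
    refine continuous_of_dominated (bound := fun z => ‖g z‖ * ‖u‖) (fun σ => ?_)
      (fun σ => .of_forall fun z => ?_) (hg.norm.mul_const _) (.of_forall fun z => ?_)
    · exact hg.aestronglyMeasurable.smul
        ((continuous_translateL1 u).comp (continuous_const_smul σ)).aestronglyMeasurable
    · rw [norm_smul, norm_translateL1]
    · exact ((continuous_translateL1 u).comp
        ((continuous_id (X := ℝ)).smul continuous_const)).const_smul (g z)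
  simpa only [hlim] using hcont.tendsto 0

/-- A probability density lies in the `L¹`-closed convex hull of the location-scale family of any
other probability density. -/
theorem toL1_mem_closure_convexHull_locationScale {f g : E → ℝ} (hf0 : ∀ x, 0 ≤ f x)
    (hf : Integrable f ν) (hfm : Measurable f) (hf1 : ∫ x, f x ∂ν = 1)
    (hg : Integrable g ν) (hg1 : ∫ x, g x ∂ν = 1) :
    hf.toL1 f ∈ closure (convexHull ℝ {u : E →₁[ν] ℝ | ∃ (y : E) (σ : ℝ), 0 < σ ∧
      u =ᵐ[ν] fun x => (σ ^ Module.finrank ℝ E)⁻¹ * g (σ⁻¹ • (x - y))}) := by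
  refine isClosed_closure.mem_of_tendsto
    ((tendsto_integral_smul_translateL1 hg hg1 (hf.toL1 f)).mono_left
      (nhdsWithin_le_nhds (s := Set.Ioi 0))) ?_
  filter_upwards [self_mem_nhdsWithin] with σ hσ
  replace hσ : 0 < σ := hσ
  have hgσ : Integrable (fun x => (σ ^ Module.finrank ℝ E)⁻¹ * g (σ⁻¹ • x)) ν :=
    (hg.comp_smul (inv_ne_zero hσ.ne')).const_mul _
  have heq : ∫ z, g z • translateL1 (σ • z) (hf.toL1 f) ∂ν =
      ∫ y, f y • translateL1 y (hgσ.toL1 _) ∂ν := by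
    rw [integral_smul_translateL1_comm hf hgσ]
    have := Measure.integral_comp_smul_of_nonneg ν
      (fun y => g (σ⁻¹ • y) • translateL1 y (hf.toL1 f)) σ (hR := hσ.le)
    simp only [inv_smul_smul₀ hσ.ne'] at this
    rw [this, ← integral_smul]
    simp only [mul_smul]
  rw [heq]
  exact integral_smul_mem_closure_convexHull hf0 hf hfm hf1 (integrable_smul_translateL1 hf _)
    fun y => ⟨y, σ, hσ, translateL1_toL1_ae_eq y hgσ⟩

end L1Translation

/-- Theorem (f): if `f` is a continuous pdf and `g` is a pdf in the class `𝒱`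
(continuous, vanishing at infinity, with tail bound `|g(x)| ≤ β(1+‖x‖)^{-n-θ}`),
then for every `ε > 0` some finite location-scale mixture of `g` is within `ε` of `f`
in `L¹` norm. -/
theorem stmt_9 (n : ℕ) (f g : EuclideanSpace ℝ (Fin n) → ℝ)
    (hf0 : ∀ x, 0 ≤ f x) (hfint : Integrable f) (hf1 : ∫ x, f x = 1)
    (hfc : Continuous f)
    (hg0 : ∀ x, 0 ≤ g x) (hgint : Integrable g) (hg1 : ∫ x, g x = 1)
    (hgc : Continuous g)
    (hgC0 : Tendsto g (cocompact (EuclideanSpace ℝ (Fin n))) (𝓝 0))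
    (β θ : ℝ) (hβ : 0 < β) (hθ : 0 < θ)
    (hgV : ∀ x, |g x| ≤ β * (1 + ‖x‖) ^ (-((n : ℝ) + θ)))
    (ε : ℝ) (hε : 0 < ε) :
    ∃ (m : ℕ) (c : Fin m → ℝ) (μ : Fin m → EuclideanSpace ℝ (Fin n)) (σ : Fin m → ℝ),
      (∀ i, 0 < σ i) ∧ (∀ i, 0 ≤ c i) ∧ (∑ i, c i = 1) ∧
      eLpNorm (fun x =>
          f x - ∑ i, c i * ((σ i) ^ n)⁻¹ * g ((σ i)⁻¹ • (x - μ i))) 1 volume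
        < ENNReal.ofReal ε := by
  obtain ⟨h, hh, hdist⟩ := Metric.mem_closure_iff.1
    (toL1_mem_closure_convexHull_locationScale hf0 hfint hfc.measurable hf1 hgint hg1) ε hε
  obtain ⟨ι, _, w, z, hw0, hw1, hz, rfl⟩ := mem_convexHull_iff_exists_fintype.1 hh
  choose y σ hσ hzσ using hz
  simp only [finrank_euclideanSpace_fin] at hzσ
  let e := (Fintype.equivFin ι).symm
  refine ⟨Fintype.card ι, w ∘ e, y ∘ e, σ ∘ e, fun i => hσ _, fun i => hw0 _,
    (e.sum_comp w).trans hw1, ?_⟩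
  rw [← edist_lt_ofReal, Lp.edist_def] at hdist
  refine (eLpNorm_congr_ae ?_).trans_lt hdist
  have hsum : (∑ i, w i • z i : EuclideanSpace ℝ (Fin n) →₁[volume] ℝ) =ᵐ[volume]
      fun x => ∑ i, w i * z i x := by
    refine (Lp.coeFn_finsetSum _ _).trans ?_
    filter_upwards [ae_all_iff.2 fun i => Lp.coeFn_smul (w i) (z i)] with x hx
    simp [hx]
  filter_upwards [hfint.coeFn_toL1, hsum, ae_all_iff.2 hzσ] with x hfx hsx hzx
  simp only [Pi.sub_apply, hfx, hsx, hzx, Function.comp_apply, ← mul_assoc]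
  rw [e.sum_comp fun i => w i * (σ i ^ n)⁻¹ * g ((σ i)⁻¹ • (x - y i))]
end
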